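/- Assume the square-integrability condition, the surjectivity assumption, and that π(s₁)* = Id_H for some s₁ in the support of μ. Let X be a Banach space and S ∈ B(X, H). Then the following are equivalent: (1) S is a compact operator; (2) for some (equivalently, for every) unit vector w ∈ H and every ε > 0 there is a compact set L ⊆ Σ such that sup_{‖x‖_X ≤ 1} ( ∫_{Σ∖L} |⟨π(s)(Sx), w⟩|² dμ(s) )^{1/2} ≤ ε; (3) for every ε > 0 there exists f ∈ C_c(Σ) with ‖Π(f)∘S − S‖_{B(X,H)} ≤ ε; (4) the map Σ ∋ s ↦ π(s)*∘S ∈ B(X, H) is continuous for the operator norm on B(X, H). -/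

import Mathlib

open MeasureTheory ComplexConjugate
open scoped ComplexInnerProductSpace Topology

section CoherentStates

variable {Sp : Type*} [TopologicalSpace Sp] [MeasurableSpace Sp] [BorelSpace Sp]
  {μ : Measure Sp}
  {H : Type*} [NormedAddCommGroup H] [InnerProductSpace ℂ H] [CompleteSpace H]
  {π : Sp → H →L[ℂ] H}

omit [MeasurableSpace Sp] [BorelSpace Sp] in
theorem continuous_coefficient
    (hcont : ∀ u : H, Continuous fun s => ContinuousLinearMap.adjoint (π s) u) (u v : H) :
    Continuous fun s => ⟪v, π s u⟫ := by
  simp_rw [← ContinuousLinearMap.adjoint_inner_left]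
  exact (hcont v).inner continuous_const

theorem memLp_coefficient
    (hcont : ∀ u : H, Continuous fun s => ContinuousLinearMap.adjoint (π s) u)
    (hsq : ∀ u v : H, ∫ s, ‖⟪v, π s u⟫‖ ^ 2 ∂μ = ‖u‖ ^ 2 * ‖v‖ ^ 2) (u v : H) :
    MemLp (fun s => ⟪v, π s u⟫) 2 μ := by
  rcases eq_or_ne u 0 with rfl | hu
  · simp
  rcases eq_or_ne v 0 with rfl | hv
  · simp
  rw [memLp_two_iff_integrable_sq_norm
    (continuous_coefficient hcont u v).aestronglyMeasurable]
  refine Integrable.of_integral_ne_zero ?_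
  rw [hsq]
  positivity

theorem norm_toLp_two_sq {α E : Type*} [MeasurableSpace α] {ν : Measure α}
    [NormedAddCommGroup E] [InnerProductSpace ℂ E] {f : α → E} (hf : MemLp f 2 ν) :
    ‖hf.toLp f‖ ^ 2 = ∫ a, ‖f a‖ ^ 2 ∂ν := by
  have h : (‖hf.toLp f‖ : ℂ) ^ 2 = ∫ a, ⟪f a, f a⟫ ∂ν := by
    have := inner_self_eq_norm_sq_to_K (𝕜 := ℂ) (hf.toLp f)
    rw [L2.inner_def] at this
    refine this.symm.trans (integral_congr_ae ?_)
    filter_upwards [hf.coeFn_toLp] with a ha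
    rw [ha]
  simp_rw [inner_self_eq_norm_sq_to_K (𝕜 := ℂ)] at h
  have h2 : ∫ a, ((‖f a‖ : ℂ)) ^ 2 ∂ν = ((∫ a, ‖f a‖ ^ 2 ∂ν : ℝ) : ℂ) := by
    rw [← integral_complex_ofReal]
    simp
  rw [show (∫ a, ((RCLike.ofReal ‖f a‖ : ℂ)) ^ 2 ∂ν) = _ from h2] at h
  exact_mod_cast h

theorem inner_toLp_two {α E : Type*} [MeasurableSpace α] {ν : Measure α}
    [NormedAddCommGroup E] [InnerProductSpace ℂ E] {f g : α → E}
    (hf : MemLp f 2 ν) (hg : MemLp g 2 ν) :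
    ⟪hf.toLp f, hg.toLp g⟫ = ∫ a, ⟪f a, g a⟫ ∂ν := by
  rw [L2.inner_def]
  refine integral_congr_ae ?_
  filter_upwards [hf.coeFn_toLp, hg.coeFn_toLp] with a ha hb
  rw [ha, hb]

theorem norm_integral_inner_le_sqrt_mul_sqrt {α E : Type*} [MeasurableSpace α] {ν : Measure α}
    [NormedAddCommGroup E] [InnerProductSpace ℂ E] {f g : α → E}
    (hf : MemLp f 2 ν) (hg : MemLp g 2 ν) :
    ‖∫ a, ⟪f a, g a⟫ ∂ν‖ ≤ √(∫ a, ‖f a‖ ^ 2 ∂ν) * √(∫ a, ‖g a‖ ^ 2 ∂ν) := by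
  rw [← inner_toLp_two hf hg, ← norm_toLp_two_sq hf, ← norm_toLp_two_sq hg,
    Real.sqrt_sq (norm_nonneg _), Real.sqrt_sq (norm_nonneg _)]
  exact norm_inner_le_norm _ _

/-- The coefficient transform `u ↦ ⟨w, π(·)u⟩` of `H` into `L²`. -/
noncomputable def coefficientL
    (hcont : ∀ u : H, Continuous fun s => ContinuousLinearMap.adjoint (π s) u)
    (hsq : ∀ u v : H, ∫ s, ‖⟪v, π s u⟫‖ ^ 2 ∂μ = ‖u‖ ^ 2 * ‖v‖ ^ 2) (w : H) :
    H →L[ℂ] Lp ℂ 2 μ :=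
  LinearMap.mkContinuous
    { toFun := fun u => (memLp_coefficient hcont hsq u w).toLp _
      map_add' := fun u v => by
        rw [← MemLp.toLp_add]
        exact MemLp.toLp_congr _ _ (.of_forall fun s => by simp)
      map_smul' := fun c u => by
        rw [RingHom.id_apply, ← MemLp.toLp_const_smul]
        exact MemLp.toLp_congr _ _ (.of_forall fun s => by simp) }
    ‖w‖ fun u => by
      refine (sq_le_sq₀ (norm_nonneg _) (by positivity)).1 ?_
      simp only [LinearMap.coe_mk, AddHom.coe_mk]
      rw [norm_toLp_two_sq, hsq, mul_pow, mul_comm]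

section

variable (hcont : ∀ u : H, Continuous fun s => ContinuousLinearMap.adjoint (π s) u)
  (hsq : ∀ u v : H, ∫ s, ‖⟪v, π s u⟫‖ ^ 2 ∂μ = ‖u‖ ^ 2 * ‖v‖ ^ 2)

theorem coefficientL_apply (w u : H) :
    coefficientL hcont hsq w u = (memLp_coefficient hcont hsq u w).toLp _ := rfl

theorem norm_coefficientL_apply (w u : H) :
    ‖coefficientL hcont hsq w u‖ = ‖w‖ * ‖u‖ := by
  rw [← sq_eq_sq₀ (norm_nonneg _) (by positivity), coefficientL_apply, norm_toLp_two_sq, hsq,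
    mul_pow, mul_comm]

theorem coefficientL_add (w w' : H) :
    coefficientL hcont hsq (w + w') = coefficientL hcont hsq w + coefficientL hcont hsq w' := by
  ext1 u
  simp only [_root_.add_apply, coefficientL_apply]
  rw [← MemLp.toLp_add]
  exact MemLp.toLp_congr _ _ (.of_forall fun s => by simp)

theorem coefficientL_smul (c : ℂ) (w : H) :
    coefficientL hcont hsq (c • w) = conj c • coefficientL hcont hsq w := by
  ext1 u
  simp only [_root_.smul_apply, coefficientL_apply]
  rw [← MemLp.toLp_const_smul]
  exact MemLp.toLp_congr _ _ (.of_forall fun s => by simp [mul_comm])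

theorem inner_coefficientL_same (w v u : H) :
    ⟪coefficientL hcont hsq w v, coefficientL hcont hsq w u⟫ = ‖w‖ ^ 2 * ⟪v, u⟫ := by
  rw [inner_eq_sum_norm_sq_div_four, inner_eq_sum_norm_sq_div_four v u]
  simp only [← map_smul, ← map_add, ← map_sub, norm_coefficientL_apply]
  rw [show (RCLike.ofReal : ℝ → ℂ) = Complex.ofReal from rfl]
  push_cast
  ring

/-- The orthogonality relations for the coefficients of `π`. -/
theorem inner_coefficientL (w' w v u : H) :
    ⟪coefficientL hcont hsq w' v, coefficientL hcont hsq w u⟫ = ⟪w, w'⟫ * ⟪v, u⟫ := by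
  have h (z : H) := inner_coefficientL_same hcont hsq z v u
  have e (z : H) : ((‖z‖ : ℂ)) ^ 2 = ⟪z, z⟫ := (inner_self_eq_norm_sq_to_K z).symm
  have h₁ := h w
  have h₂ := h w'
  have h₃ := h (w + w')
  have h₄ := h (w + Complex.I • w')
  simp only [e, coefficientL_add, coefficientL_smul, _root_.add_apply,
    _root_.smul_apply, inner_add_left, inner_add_right, inner_smul_left,
    inner_smul_right, Complex.conj_I, map_neg] at h₁ h₂ h₃ h₄
  linear_combination (-(1 - Complex.I) / 2) * h₁ + (-(1 - Complex.I) / 2) * h₂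
    + (1 / 2) * h₃ - (Complex.I / 2) * h₄
    + (⟪coefficientL hcont hsq w' v, coefficientL hcont hsq w u⟫
      - ⟪coefficientL hcont hsq w v, coefficientL hcont hsq w' u⟫
      - Complex.I * ⟪coefficientL hcont hsq w' v, coefficientL hcont hsq w' u⟫
      + ⟪v, u⟫ * (⟪w', w⟫ - ⟪w, w'⟫ + Complex.I * ⟪w', w'⟫)) / 2 * Complex.I_sq

end

theorem isCompactOperator_smulRight {E F : Type*} [NormedAddCommGroup E] [NormedSpace ℂ E]
    [NormedAddCommGroup F] [NormedSpace ℂ F] (φ : E →L[ℂ] ℂ) (y : F) :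
    IsCompactOperator (φ.smulRight y) :=
  (isCompactOperator_of_locallyCompactSpace_dom φ).clm_comp
    (ContinuousLinearMap.toSpanSingleton ℂ y)

theorem integral_mem_of_isClosed {α E : Type*} [MeasurableSpace α] {ν : Measure α}
    [NormedAddCommGroup E] [NormedSpace ℂ E] [CompleteSpace E] {K : Submodule ℂ E}
    (hK : IsClosed (K : Set E)) {f : α → E} (hf : ∀ a, f a ∈ K) : ∫ a, f a ∂ν ∈ K := by
  have : CompleteSpace K := hK.completeSpace_coe
  have h := K.subtypeₗᵢ.integral_comp_comm (μ := ν) (fun a => (⟨f a, hf a⟩ : K))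
  simp only [Submodule.coe_subtypeₗᵢ, Submodule.subtype_apply] at h
  rw [h]
  exact Subtype.mem _

theorem isClosed_compactOperator (E F : Type*) [NormedAddCommGroup E] [NormedSpace ℂ E]
    [NormedAddCommGroup F] [NormedSpace ℂ F] [CompleteSpace F] :
    IsClosed (compactOperator (RingHom.id ℂ) E F : Set (E →L[ℂ] F)) :=
  isClosed_setOfPred_isCompactOperator

theorem isCompactOperator_of_forall_exists_norm_sub_le {E F : Type*} [NormedAddCommGroup E]
    [NormedSpace ℂ E] [NormedAddCommGroup F] [NormedSpace ℂ F] [CompleteSpace F] {S : E →L[ℂ] F}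
    (h : ∀ ε > (0 : ℝ), ∃ T : E →L[ℂ] F, IsCompactOperator T ∧
      ∀ x, ‖x‖ ≤ 1 → ‖T x - S x‖ ≤ ε) :
    IsCompactOperator S := by
  suffices hS : S ∈ closure (compactOperator (RingHom.id ℂ) E F : Set (E →L[ℂ] F)) from
    (isClosed_compactOperator E F).closure_subset hS
  refine Metric.mem_closure_iff.2 fun ε hε => ?_
  obtain ⟨T, hT, hTS⟩ := h (ε / 2) (by positivity)
  refine ⟨T, hT, ?_⟩
  rw [dist_comm, dist_eq_norm]
  refine (ContinuousLinearMap.opNorm_le_of_unit_norm (by positivity) fun x hx => ?_).trans_lt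
    (half_lt_self hε)
  exact hTS x hx.le

section

variable (hcont : ∀ u : H, Continuous fun s => ContinuousLinearMap.adjoint (π s) u)
  (hsq : ∀ u v : H, ∫ s, ‖⟪v, π s u⟫‖ ^ 2 ∂μ = ‖u‖ ^ 2 * ‖v‖ ^ 2)

variable (μ π) in
/-- The localization operator `u ↦ ∫_L ⟨w, π(s)u⟩ π(s)*w dμ(s)`. -/
noncomputable def localizationOp (w : H) (L : Set Sp) : H →L[ℂ] H :=
  ∫ s in L, (innerSL ℂ (ContinuousLinearMap.adjoint (π s) w)).smulRight
    (ContinuousLinearMap.adjoint (π s) w) ∂μ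

omit [TopologicalSpace Sp] [BorelSpace Sp] in
theorem isCompactOperator_localizationOp (w : H) (L : Set Sp) :
    IsCompactOperator (localizationOp μ π w L) := by
  refine integral_mem_of_isClosed (isClosed_compactOperator H H) fun s => ?_
  exact isCompactOperator_smulRight _ _

include hcont in
theorem inner_localizationOp [T2Space Sp] [IsFiniteMeasureOnCompacts μ] (w : H) {L : Set Sp}
    (hL : IsCompact L) (v u : H) :
    ⟪v, localizationOp μ π w L u⟫ = ∫ s in L, ⟪⟪w, π s v⟫, ⟪w, π s u⟫⟫ ∂μ := by
  have hc : Continuous fun s => (innerSL ℂ (ContinuousLinearMap.adjoint (π s) w)).smulRight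
      (ContinuousLinearMap.adjoint (π s) w) :=
    ((ContinuousLinearMap.smulRightL ℂ H H).continuous.comp
      ((innerSL ℂ).continuous.comp (hcont w))).clm_apply (hcont w)
  have hi : Integrable _ (μ.restrict L) := hc.continuousOn.integrableOn_compact hL
  rw [localizationOp, ContinuousLinearMap.integral_apply hi, ← integral_inner]
  · refine integral_congr_ae (.of_forall fun s => ?_)
    simp [inner_smul_right,
      ContinuousLinearMap.adjoint_inner_left, ContinuousLinearMap.adjoint_inner_right]
  · exact hi.apply_continuousLinearMap u

include hcont hsq in
theorem norm_sub_localizationOp_apply_le [T2Space Sp] [IsFiniteMeasureOnCompacts μ] {w : H}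
    (hw : ‖w‖ = 1) {L : Set Sp} (hL : IsCompact L) (u : H) :
    ‖localizationOp μ π w L u - u‖ ≤ √(∫ s in Lᶜ, ‖⟪w, π s u⟫‖ ^ 2 ∂μ) := by
  have hm (z : H) := memLp_coefficient hcont hsq z w
  have key (v : H) : ⟪v, u - localizationOp μ π w L u⟫
      = ∫ s in Lᶜ, ⟪⟪w, π s v⟫, ⟪w, π s u⟫⟫ ∂μ := by
    have h := inner_coefficientL_same hcont hsq w v u
    rw [coefficientL_apply, coefficientL_apply, inner_toLp_two, hw] at h
    have hi : Integrable (fun s => ⟪⟪w, π s v⟫, ⟪w, π s u⟫⟫) μ := by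
      refine (L2.integrable_inner ((hm v).toLp _) ((hm u).toLp _)).congr ?_
      filter_upwards [(hm v).coeFn_toLp, (hm u).coeFn_toLp] with s h₁ h₂
      rw [h₁, h₂]
    rw [← integral_add_compl hL.measurableSet hi] at h
    rw [inner_sub_right, inner_localizationOp hcont w hL, sub_eq_iff_eq_add', h]
    simp
  set r := u - localizationOp μ π w L u with hr
  have h₁ : ‖r‖ ^ 2 ≤ ‖r‖ * √(∫ s in Lᶜ, ‖⟪w, π s u⟫‖ ^ 2 ∂μ) := by
    calc ‖r‖ ^ 2 = ‖⟪r, r⟫‖ := by rw [inner_self_eq_norm_sq_to_K]; simp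
      _ ≤ √(∫ s in Lᶜ, ‖⟪w, π s r⟫‖ ^ 2 ∂μ) * √(∫ s in Lᶜ, ‖⟪w, π s u⟫‖ ^ 2 ∂μ) := by
        rw [key r]
        exact norm_integral_inner_le_sqrt_mul_sqrt ((hm r).restrict _) ((hm u).restrict _)
      _ ≤ _ := by
        gcongr
        refine Real.sqrt_le_left (norm_nonneg _) |>.2 ?_
        refine (setIntegral_le_integral ((hm r).integrable_norm_pow (by simp)) ?_).trans_eq ?_
        · exact .of_forall fun s => by positivity
        · rw [hsq, hw]; simp
  rw [norm_sub_rev, ← hr]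
  rcases (norm_nonneg r).eq_or_lt with h0 | h0
  · rw [← h0]; positivity
  · exact le_of_mul_le_mul_left (by linarith [sq ‖r‖]) h0

/-- The integrated map `Π` extended to `L²`. -/
noncomputable def integratedL : Lp ℂ 2 μ →L[ℂ] H →L[ℂ] H :=
  LinearMap.mkContinuous₂
    (LinearMap.mk₂ ℂ
      (fun f u => ContinuousLinearMap.adjoint (coefficientL hcont hsq u) f)
      (fun f g u => map_add _ f g)
      (fun c f u => map_smul _ c f)
      (fun f u v => by rw [coefficientL_add, map_add, _root_.add_apply])
      (fun c f u => by rw [coefficientL_smul, map_smulₛₗ, _root_.smul_apply,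
        starRingEnd_self_apply]))
    1 fun f u => by
      rw [LinearMap.mk₂_apply, one_mul, mul_comm]
      refine ContinuousLinearMap.le_of_opNorm_le _ ?_ f
      rw [LinearIsometryEquiv.norm_map]
      exact ContinuousLinearMap.opNorm_le_bound _ (norm_nonneg _) fun v =>
        (norm_coefficientL_apply hcont hsq u v).le

theorem integratedL_apply (f : Lp ℂ 2 μ) (u : H) :
    integratedL hcont hsq f u = ContinuousLinearMap.adjoint (coefficientL hcont hsq u) f := rfl

theorem integratedL_coefficientL (b a u : H) :
    integratedL hcont hsq (coefficientL hcont hsq b a) u = ⟪b, u⟫ • a :=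
  ext_inner_left ℂ fun v => by
    rw [integratedL_apply, ContinuousLinearMap.adjoint_inner_right, inner_coefficientL,
      inner_smul_right]

theorem isCompactOperator_integratedL
    (hsurj : (Submodule.span ℂ {f : Lp ℂ 2 μ | ∃ u v : H,
        (f : Sp → ℂ) =ᵐ[μ] fun s => ⟪v, π s u⟫}).topologicalClosure = ⊤) (f : Lp ℂ 2 μ) :
    IsCompactOperator (integratedL hcont hsq f) := by
  let K := (compactOperator (RingHom.id ℂ) H H).comap (integratedL hcont hsq).toLinearMap
  have hK : IsClosed (K : Set (Lp ℂ 2 μ)) :=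
    (isClosed_compactOperator H H).preimage (integratedL hcont hsq).continuous
  have hle : (⊤ : Submodule ℂ (Lp ℂ 2 μ)) ≤ K := by
    rw [← hsurj]
    refine Submodule.topologicalClosure_minimal _ (Submodule.span_le.2 ?_) hK
    rintro g ⟨a, b, hg⟩
    have hg' : g = coefficientL hcont hsq b a :=
      Lp.ext (hg.trans (memLp_coefficient hcont hsq a b).coeFn_toLp.symm)
    have : integratedL hcont hsq g = (innerSL ℂ b).smulRight a := by
      ext1 u
      rw [hg', integratedL_coefficientL]
      rfl
    change IsCompactOperator (integratedL hcont hsq g)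
    rw [this]
    exact isCompactOperator_smulRight _ _
  exact hle (Submodule.mem_top (x := f))

theorem integral_smul_adjoint_eq_integratedL [IsFiniteMeasureOnCompacts μ]
    [TopologicalSpace.SeparableSpace H] {f : Sp → ℂ}
    (hf : Continuous f) (hfc : HasCompactSupport f) (u : H) :
    ∫ s, f s • ContinuousLinearMap.adjoint (π s) u ∂μ
      = integratedL hcont hsq ((hf.memLp_of_hasCompactSupport hfc).toLp f) u := by
  refine ext_inner_left ℂ fun v => ?_
  rw [integratedL_apply, ContinuousLinearMap.adjoint_inner_right, coefficientL_apply,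
    inner_toLp_two, ← integral_inner]
  · refine integral_congr_ae (.of_forall fun s => ?_)
    simp [inner_smul_right, ContinuousLinearMap.adjoint_inner_right]
  · exact (hf.smul (hcont u)).integrable_of_hasCompactSupport hfc.smul_right

end

theorem exists_finite_net_of_isCompactOperator {E F : Type*} [NormedAddCommGroup E]
    [NormedSpace ℂ E] [NormedAddCommGroup F] [NormedSpace ℂ F] {S : E →L[ℂ] F}
    (hS : IsCompactOperator S) {δ : ℝ} (hδ : 0 < δ) :
    ∃ t : Set F, t.Finite ∧ ∀ x, ‖x‖ ≤ 1 → ∃ y ∈ t, ‖S x - y‖ < δ := by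
  have hc : IsCompact (closure (S '' Metric.closedBall 0 1)) :=
    IsCompactOperator.isCompact_closure_image_closedBall (f := (S : E →ₗ[ℂ] F)) hS 1
  obtain ⟨t, ht, hcov⟩ := Metric.totallyBounded_iff.1 hc.totallyBounded δ hδ
  refine ⟨t, ht, fun x hx => ?_⟩
  have hmem := hcov (subset_closure (Set.mem_image_of_mem S (mem_closedBall_zero_iff.2 hx)))
  simpa [dist_eq_norm] using hmem

omit [BorelSpace Sp] in
theorem exists_isCompact_setIntegral_compl_lt [T2Space Sp] [SigmaCompactSpace Sp]
    [OpensMeasurableSpace Sp] {g : Sp → ℝ} (hg : Integrable g μ) {ε : ℝ} (hε : 0 < ε) :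
    ∃ L : Set Sp, IsCompact L ∧ ∫ s in Lᶜ, g s ∂μ < ε := by
  have hlim := tendsto_setIntegral_of_antitone (μ := μ) (f := g)
    (s := fun n => (compactCovering Sp n)ᶜ)
    (fun n => (isCompact_compactCovering Sp n).measurableSet.compl)
    (fun m n h => Set.compl_subset_compl.2 (compactCovering_subset Sp h)) ⟨0, hg.integrableOn⟩
  rw [← Set.compl_iUnion, iUnion_compactCovering, Set.compl_univ, setIntegral_empty] at hlim
  obtain ⟨n, hn⟩ := (hlim.eventually_lt_const hε).exists
  exact ⟨_, isCompact_compactCovering Sp n, hn⟩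

section

variable (hcont : ∀ u : H, Continuous fun s => ContinuousLinearMap.adjoint (π s) u)
  (hsq : ∀ u v : H, ∫ s, ‖⟪v, π s u⟫‖ ^ 2 ∂μ = ‖u‖ ^ 2 * ‖v‖ ^ 2)
  {X : Type*} [NormedAddCommGroup X] [NormedSpace ℂ X] {S : X →L[ℂ] H}

include hcont hsq in
theorem exists_isCompact_sqrt_setIntegral_compl_le [T2Space Sp] [SigmaCompactSpace Sp]
    (hS : IsCompactOperator S) {w : H} (hw : ‖w‖ = 1) {ε : ℝ} (hε : 0 < ε) :
    ∃ L : Set Sp, IsCompact L ∧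
      ∀ x : X, ‖x‖ ≤ 1 → √(∫ s in Lᶜ, ‖⟪w, π s (S x)⟫‖ ^ 2 ∂μ) ≤ ε := by
  have hi (z : H) : Integrable (fun s => ‖⟪w, π s z⟫‖ ^ 2) μ :=
    (memLp_coefficient hcont hsq z w).integrable_norm_pow (by simp)
  obtain ⟨t, ht, hnet⟩ := exists_finite_net_of_isCompactOperator hS (half_pos hε)
  choose L hL hLt using fun y : H =>
    exists_isCompact_setIntegral_compl_lt (hi y) (ε := (ε / 2) ^ 2) (by positivity)
  refine ⟨⋃ y ∈ t, L y, ht.isCompact_biUnion fun y _ => hL y, fun x hx => ?_⟩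
  obtain ⟨y, hy, hxy⟩ := hnet x hx
  have hsub : (⋃ y ∈ t, L y)ᶜ ⊆ (L y)ᶜ :=
    Set.compl_subset_compl.2 (Set.subset_biUnion_of_mem (u := L) hy)
  refine Real.sqrt_le_left hε.le |>.2 ?_
  calc ∫ s in (⋃ y ∈ t, L y)ᶜ, ‖⟪w, π s (S x)⟫‖ ^ 2 ∂μ
      ≤ ∫ s in (L y)ᶜ, ‖⟪w, π s (S x)⟫‖ ^ 2 ∂μ :=
        setIntegral_mono_set (hi _).integrableOn (.of_forall fun s => by positivity)
          hsub.eventuallyLE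
    _ ≤ ∫ s in (L y)ᶜ, (2 * ‖⟪w, π s (S x - y)⟫‖ ^ 2 + 2 * ‖⟪w, π s y⟫‖ ^ 2) ∂μ := by
        refine integral_mono (hi _).integrableOn
          (((hi _).const_mul 2).add ((hi _).const_mul 2)).integrableOn fun s => ?_
        have h : ‖⟪w, π s (S x)⟫‖ ≤ ‖⟪w, π s (S x - y)⟫‖ + ‖⟪w, π s y⟫‖ := by
          refine (norm_add_le _ _).trans' (le_of_eq ?_)
          rw [← inner_add_right, ← map_add, sub_add_cancel]
        dsimp only
        nlinarith [norm_nonneg ⟪w, π s (S x)⟫,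
          sq_nonneg (‖⟪w, π s (S x - y)⟫‖ - ‖⟪w, π s y⟫‖)]
    _ = 2 * ∫ s in (L y)ᶜ, ‖⟪w, π s (S x - y)⟫‖ ^ 2 ∂μ
        + 2 * ∫ s in (L y)ᶜ, ‖⟪w, π s y⟫‖ ^ 2 ∂μ := by
        rw [integral_add ((hi _).const_mul 2).integrableOn ((hi _).const_mul 2).integrableOn,
          integral_const_mul, integral_const_mul]
    _ ≤ 2 * (ε / 2) ^ 2 + 2 * (ε / 2) ^ 2 := by
        have h : ∫ s in (L y)ᶜ, ‖⟪w, π s (S x - y)⟫‖ ^ 2 ∂μ ≤ (ε / 2) ^ 2 := by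
          refine (setIntegral_le_integral (hi _) (.of_forall fun s => by positivity)).trans ?_
          rw [hsq, hw, one_pow, mul_one]
          gcongr
        have := (hLt y).le
        gcongr
    _ = ε ^ 2 := by ring

include hcont hsq in
theorem isCompactOperator_of_forall_sqrt_setIntegral_compl_le [T2Space Sp]
    [IsFiniteMeasureOnCompacts μ] {w : H} (hw : ‖w‖ = 1)
    (h : ∀ ε > (0 : ℝ), ∃ L : Set Sp, IsCompact L ∧
      ∀ x : X, ‖x‖ ≤ 1 → √(∫ s in Lᶜ, ‖⟪w, π s (S x)⟫‖ ^ 2 ∂μ) ≤ ε) :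
    IsCompactOperator S :=
  isCompactOperator_of_forall_exists_norm_sub_le fun ε hε => by
    obtain ⟨L, hL, hLε⟩ := h ε hε
    exact ⟨(localizationOp μ π w L).comp S, (isCompactOperator_localizationOp w L).comp_clm S,
      fun x hx => (norm_sub_localizationOp_apply_le hcont hsq hw hL (S x)).trans (hLε x hx)⟩

omit [MeasurableSpace Sp] [BorelSpace Sp] in
include hcont in
theorem continuous_adjoint_comp_of_isCompactOperator [LocallyCompactSpace Sp]
    (hS : IsCompactOperator S) :
    Continuous fun s : Sp => (ContinuousLinearMap.adjoint (π s)).comp S := by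
  refine continuous_iff_continuousAt.2 fun s₀ => ?_
  obtain ⟨N, hN, hNs₀⟩ := exists_compact_mem_nhds s₀
  obtain ⟨C, hC⟩ := banach_steinhaus (g := fun s : N => ContinuousLinearMap.adjoint (π s))
    fun u => by
      obtain ⟨M, hM⟩ := hN.exists_bound_of_continuousOn (hcont u).continuousOn
      exact ⟨M, fun s => hM s s.2⟩
  have hC₀ : 0 ≤ C := (norm_nonneg _).trans (hC ⟨s₀, mem_of_mem_nhds hNs₀⟩)
  refine Metric.tendsto_nhds.2 fun ε hε => ?_
  obtain ⟨t, ht, hnet⟩ := exists_finite_net_of_isCompactOperator hS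
    (show 0 < ε / (4 * (C + 1)) by positivity)
  have hev : ∀ᶠ s in 𝓝 s₀, ∀ y ∈ t,
      ‖ContinuousLinearMap.adjoint (π s) y - ContinuousLinearMap.adjoint (π s₀) y‖ < ε / 4 := by
    refine (Filter.eventually_all_finite ht).2 fun y _ => ?_
    simpa [dist_eq_norm] using
      Metric.tendsto_nhds.1 (hcont y).continuousAt (ε / 4) (by positivity)
  filter_upwards [hev, hNs₀] with s hs hsN
  rw [dist_eq_norm]
  refine (ContinuousLinearMap.opNorm_le_of_unit_norm (C := 3 * ε / 4) (by positivity)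
    fun x hx => ?_).trans_lt (by linarith)
  obtain ⟨y, hy, hxy⟩ := hnet x hx.le
  have hb (s : N) : ‖ContinuousLinearMap.adjoint (π s) (S x - y)‖ ≤ ε / 4 := by
    refine (ContinuousLinearMap.le_of_opNorm_le _ (hC s) _).trans ?_
    calc C * ‖S x - y‖ ≤ (C + 1) * (ε / (4 * (C + 1))) := by gcongr; linarith
      _ = ε / 4 := by field_simp
  have h₁ := hb ⟨s, hsN⟩
  have h₂ := hb ⟨s₀, mem_of_mem_nhds hNs₀⟩
  have h₃ := hs y hy
  calc _ = ‖ContinuousLinearMap.adjoint (π s) (S x - y)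
        - ContinuousLinearMap.adjoint (π s₀) (S x - y)
        + (ContinuousLinearMap.adjoint (π s) y - ContinuousLinearMap.adjoint (π s₀) y)‖ := by
        congr 1
        simp only [map_sub, _root_.sub_apply, ContinuousLinearMap.comp_apply]
        abel
    _ ≤ ε / 4 + ε / 4 + ε / 4 :=
        (norm_add_le _ _).trans (add_le_add ((norm_sub_le _ _).trans (add_le_add h₁ h₂)) h₃.le)
    _ = 3 * ε / 4 := by ring

include hcont in
theorem exists_norm_integral_smul_adjoint_sub_le [T2Space Sp] [LocallyCompactSpace Sp]
    [IsFiniteMeasureOnCompacts μ] [TopologicalSpace.SeparableSpace H]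
    {s₁ : Sp} (hs₁ : ∀ U ∈ 𝓝 s₁, μ U ≠ 0)
    (hid : ContinuousLinearMap.adjoint (π s₁) = ContinuousLinearMap.id ℂ H)
    (hS : Continuous fun s : Sp => (ContinuousLinearMap.adjoint (π s)).comp S)
    {ε : ℝ} (hε : 0 < ε) :
    ∃ f : Sp → ℂ, Continuous f ∧ HasCompactSupport f ∧ ∀ x : X, ‖x‖ ≤ 1 →
      ‖(∫ s, f s • ContinuousLinearMap.adjoint (π s) (S x) ∂μ) - S x‖ ≤ ε := by
  let U : Set Sp := {s | ‖(ContinuousLinearMap.adjoint (π s)).comp S - S‖ < ε}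
  have hU : IsOpen U := isOpen_lt (hS.sub continuous_const).norm continuous_const
  have hs₁U : s₁ ∈ U := by simpa [U, hid] using hε
  obtain ⟨g, hg₁, hgU, hgc, hg01⟩ := exists_continuous_one_zero_of_isCompact
    (isCompact_singleton (x := s₁)) hU.isClosed_compl (by simpa using hs₁U)
  have hg0 (s : Sp) : 0 ≤ g s := (hg01 s).1
  have hgi : Integrable g μ := g.continuous.integrable_of_hasCompactSupport hgc
  set c : ℝ := ∫ s, g s ∂μ with hc
  have hcpos : 0 < c := by
    rw [hc, integral_pos_iff_support_of_nonneg hg0 hgi]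
    refine pos_iff_ne_zero.2 (hs₁ _ (g.continuous.isOpen_support.mem_nhds ?_))
    simp [hg₁ rfl]
  refine ⟨fun s => ((c⁻¹ * g s : ℝ) : ℂ), by fun_prop, ?_, fun x hx => ?_⟩
  · exact hgc.comp_left (g := fun r : ℝ => ((c⁻¹ * r : ℝ) : ℂ)) (by simp)
  have hone : ∫ s, c⁻¹ * g s ∂μ = 1 := by
    rw [integral_const_mul, ← hc, inv_mul_cancel₀ hcpos.ne']
  have hint (F : Sp → H) (hF : Continuous F) :
      Integrable (fun s => ((c⁻¹ * g s : ℝ) : ℂ) • F s) μ := by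
    refine Continuous.integrable_of_hasCompactSupport (by fun_prop) ?_
    exact (hgc.comp_left (g := fun r : ℝ => ((c⁻¹ * r : ℝ) : ℂ)) (by simp)).smul_right
  have hconst : ∫ s, ((c⁻¹ * g s : ℝ) : ℂ) • S x ∂μ = S x := by
    rw [integral_smul_const, integral_complex_ofReal, hone, Complex.ofReal_one, one_smul]
  calc _ = ‖∫ s, ((c⁻¹ * g s : ℝ) : ℂ) • (ContinuousLinearMap.adjoint (π s) (S x) - S x) ∂μ‖ := by
        simp_rw [smul_sub]
        rw [integral_sub (hint _ (hcont _)) (hint _ continuous_const), hconst]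
    _ ≤ ∫ s, c⁻¹ * g s * ε ∂μ := by
        refine norm_integral_le_of_norm_le ((hgi.const_mul _).mul_const _)
          (.of_forall fun s => ?_)
        have hn : 0 ≤ c⁻¹ * g s := mul_nonneg (by positivity) (hg0 s)
        rw [norm_smul, Complex.norm_real, Real.norm_of_nonneg hn]
        by_cases hs : s ∈ U
        · gcongr
          have h := ((ContinuousLinearMap.adjoint (π s)).comp S - S).le_opNorm x
          refine h.trans ((mul_le_of_le_one_right (norm_nonneg _) hx).trans (le_of_lt hs))
        · simp [hgU hs]
    _ = ε := by rw [integral_mul_const, hone, one_mul]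

include hcont hsq in
theorem isCompactOperator_of_forall_norm_integral_smul_adjoint_sub_le
    [IsFiniteMeasureOnCompacts μ] [TopologicalSpace.SeparableSpace H]
    (hsurj : (Submodule.span ℂ {f : Lp ℂ 2 μ | ∃ u v : H,
        (f : Sp → ℂ) =ᵐ[μ] fun s => ⟪v, π s u⟫}).topologicalClosure = ⊤)
    (h : ∀ ε > (0 : ℝ), ∃ f : Sp → ℂ, Continuous f ∧ HasCompactSupport f ∧ ∀ x : X, ‖x‖ ≤ 1 →
      ‖(∫ s, f s • ContinuousLinearMap.adjoint (π s) (S x) ∂μ) - S x‖ ≤ ε) :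
    IsCompactOperator S :=
  isCompactOperator_of_forall_exists_norm_sub_le fun ε hε => by
    obtain ⟨f, hf, hfc, hfε⟩ := h ε hε
    refine ⟨(integratedL hcont hsq ((hf.memLp_of_hasCompactSupport hfc).toLp f)).comp S,
      (isCompactOperator_integratedL hcont hsq hsurj _).comp_clm S, fun x hx => ?_⟩
    rw [ContinuousLinearMap.comp_apply, ← integral_smul_adjoint_eq_integratedL hcont hsq hf hfc]
    exact hfε x hx

end

end CoherentStates

/-- Assume the square-integrability condition, the surjectivity
assumption, and that `π(s₁)* = Id_H` for some `s₁` in the support of `μ`.  Let `X` be a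
Banach space and `S ∈ B(X, H)`.  Then the following are equivalent: (1) `S` is compact;
(2) for some (equivalently, every) unit vector `w` and every `ε > 0` there is a compact
`L ⊆ Sp` with `sup_{‖x‖ ≤ 1} ( ∫_{Sp∖L} |⟨π(s)(Sx), w⟩|² dμ )^{1/2} ≤ ε`;
(3) for every `ε > 0` there is `f ∈ C_c(Sp)` with `‖Π(f)∘S − S‖ ≤ ε` (expressed via the
supremum over the closed unit ball of `X`); (4) `s ↦ π(s)* ∘ S` is norm-continuous. -/
theorem statement9
    {Sp : Type*} [TopologicalSpace Sp] [T2Space Sp] [LocallyCompactSpace Sp]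
    [SigmaCompactSpace Sp] [MeasurableSpace Sp] [BorelSpace Sp]
    (μ : Measure Sp) [μ.Regular]
    {H : Type*} [NormedAddCommGroup H] [InnerProductSpace ℂ H] [CompleteSpace H]
    [TopologicalSpace.SeparableSpace H] [Nontrivial H]
    {X : Type*} [NormedAddCommGroup X] [NormedSpace ℂ X] [CompleteSpace X]
    (π : Sp → H →L[ℂ] H)
    (hcont : ∀ u : H, Continuous fun s => ContinuousLinearMap.adjoint (π s) u)
    (hsq : ∀ u v : H, ∫ s, ‖⟪v, π s u⟫‖ ^ 2 ∂μ = ‖u‖ ^ 2 * ‖v‖ ^ 2)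
    (hsurj : (Submodule.span ℂ {f : Lp ℂ 2 μ | ∃ u v : H,
        (f : Sp → ℂ) =ᵐ[μ] fun s => ⟪v, π s u⟫}).topologicalClosure = ⊤)
    (hs₁ : ∃ s₁ : Sp, (∀ U ∈ 𝓝 s₁, μ U ≠ 0) ∧
      ContinuousLinearMap.adjoint (π s₁) = ContinuousLinearMap.id ℂ H)
    (S : X →L[ℂ] H) :
    -- (1) ↔ (2) for some unit vector
    (IsCompactOperator ⇑S ↔
      ∃ w : H, ‖w‖ = 1 ∧ ∀ ε > (0:ℝ), ∃ L : Set Sp, IsCompact L ∧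
        ∀ x : X, ‖x‖ ≤ 1 → Real.sqrt (∫ s in Lᶜ, ‖⟪w, π s (S x)⟫‖ ^ 2 ∂μ) ≤ ε) ∧
    -- (1) ↔ (2) for every unit vector
    (IsCompactOperator ⇑S ↔
      ∀ w : H, ‖w‖ = 1 → ∀ ε > (0:ℝ), ∃ L : Set Sp, IsCompact L ∧
        ∀ x : X, ‖x‖ ≤ 1 → Real.sqrt (∫ s in Lᶜ, ‖⟪w, π s (S x)⟫‖ ^ 2 ∂μ) ≤ ε) ∧
    -- (1) ↔ (3)
    (IsCompactOperator ⇑S ↔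
      ∀ ε > (0:ℝ), ∃ f : Sp → ℂ, Continuous f ∧ HasCompactSupport f ∧
        ∀ x : X, ‖x‖ ≤ 1 →
          ‖(∫ s, f s • ContinuousLinearMap.adjoint (π s) (S x) ∂μ) - S x‖ ≤ ε) ∧
    -- (1) ↔ (4)
    (IsCompactOperator ⇑S ↔
      Continuous fun s : Sp => (ContinuousLinearMap.adjoint (π s)).comp S) := by
  obtain ⟨s₁, hsupp, hid⟩ := hs₁
  obtain ⟨w₀, hw₀⟩ := exists_norm_eq H zero_le_one
  have h12 (hS : IsCompactOperator S) (w : H) (hw : ‖w‖ = 1) (ε : ℝ) (hε : ε > 0) :=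
    exists_isCompact_sqrt_setIntegral_compl_le hcont hsq hS hw hε
  have h21 {w : H} (hw : ‖w‖ = 1) :=
    isCompactOperator_of_forall_sqrt_setIntegral_compl_le (S := S) hcont hsq hw
  have h14 := continuous_adjoint_comp_of_isCompactOperator (S := S) hcont
  have h43 (hS : Continuous fun s : Sp => (ContinuousLinearMap.adjoint (π s)).comp S) (ε : ℝ)
      (hε : ε > 0) := exists_norm_integral_smul_adjoint_sub_le hcont hsupp hid hS hε
  have h31 := isCompactOperator_of_forall_norm_integral_smul_adjoint_sub_le (S := S)
    hcont hsq hsurj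
  exact ⟨⟨fun hS => ⟨w₀, hw₀, h12 hS w₀ hw₀⟩, fun ⟨_, hw, h⟩ => h21 hw h⟩,
    ⟨h12, fun h => h21 hw₀ (h w₀ hw₀)⟩, ⟨fun hS => h43 (h14 hS), h31⟩,
    ⟨h14, fun hS => h31 (h43 hS)⟩⟩
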